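/- ESO(3,3) = 4; that is, in the game A_{3,3}, player A has a strategy guaranteeing that, for every strategy of player B, among the first 4 points played there is a 3-up-run or a 3-down-run, and player B has a strategy guaranteeing that, for every strategy of player A, among the first 3 points played there is neither a 3-up-run nor a 3-down-run. -/

import Mathlib

open Set

/-- A point in the plane. -/
abbrev Pt : Type := ℝ × ℝ

/-- The point set `P` contains an `n`-up-run: `n` points with strictly increasing
`x`-coordinates and nondecreasing `y`-coordinates. -/
def HasUpRun (P : Set Pt) (n : ℕ) : Prop :=
  ∃ f : Fin n → Pt, (∀ i, f i ∈ P) ∧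
    StrictMono (fun i => (f i).1) ∧ Monotone (fun i => (f i).2)

/-- The point set `P` contains an `n`-down-run: `n` points with strictly increasing
`x`-coordinates and strictly decreasing `y`-coordinates. -/
def HasDownRun (P : Set Pt) (n : ℕ) : Prop :=
  ∃ f : Fin n → Pt, (∀ i, f i ∈ P) ∧
    StrictMono (fun i => (f i).1) ∧ StrictAnti (fun i => (f i).2)

/-- A strategy for player A: from the list of previously played points, choose
an x-coordinate. -/
abbrev AStrat : Type := List Pt → ℝ

/-- A strategy for player B: from the list of previously played points and the new
x-coordinate, choose a y-coordinate. -/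
abbrev BStrat : Type := List Pt → ℝ → ℝ

/-- Validity of a strategy for player A in either game: the chosen x-coordinate lies in
`(0,1)` and is distinct from all previously played x-coordinates. -/
def AValid (sA : AStrat) : Prop :=
  ∀ h : List Pt, sA h ∈ Ioo (0:ℝ) 1 ∧ ∀ p ∈ h, sA h ≠ p.1

/-- Validity of a strategy for player B in the game `A_{m,k}`: the chosen y-coordinate
lies in `(0,1)` and is distinct from all previously played y-coordinates. -/
def BValid (sB : BStrat) : Prop :=
  ∀ (h : List Pt) (x : ℝ), sB h x ∈ Ioo (0:ℝ) 1 ∧ ∀ p ∈ h, sB h x ≠ p.2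

/-- The list of points played in the first `n` turns when A plays `sA` and B plays `sB`. -/
def hist (sA : AStrat) (sB : BStrat) : ℕ → List Pt
  | 0 => []
  | n + 1 =>
      let h := hist sA sB n
      h ++ [(sA h, sB h (sA h))]

/-- The set of points played in the first `N` turns. -/
def played (sA : AStrat) (sB : BStrat) (N : ℕ) : Set Pt :=
  {p | p ∈ hist sA sB N}

/-- In the game `A_{m,k}`, strategy `sA` of player A is valid and guarantees an
`m`-up-run or a `k`-down-run among the first `N` points, against every valid
strategy of player B. -/
def AWinsBy (m k N : ℕ) (sA : AStrat) : Prop :=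
  AValid sA ∧ ∀ sB : BStrat, BValid sB →
    HasUpRun (played sA sB N) m ∨ HasDownRun (played sA sB N) k

/-- The Erdős–Szekeres on-line number `ESO(m,k)`: the least `N` such that player A
has a strategy forcing an `m`-up-run or a `k`-down-run within `N` turns. -/
noncomputable def ESO (m k : ℕ) : ℕ := sInf {N | ∃ sA : AStrat, AWinsBy m k N sA}

/-- Validity of a strategy for player B in the tier game `B_{m,k}`: the chosen
y-coordinate is an integer in `{1, …, k-1}` (repetitions allowed). -/
def BTierValid (k : ℕ) (sB : BStrat) : Prop :=
  ∀ (h : List Pt) (x : ℝ), ∃ j : ℕ, 1 ≤ j ∧ j ≤ k - 1 ∧ sB h x = (j : ℝ)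

/-- In the tier game `B_{m,k}`, strategy `sA` of player A is valid and guarantees an
`m`-up-run among the first `N` points, against every valid strategy of player B. -/
def AWinsTierBy (m k N : ℕ) (sA : AStrat) : Prop :=
  AValid sA ∧ ∀ sB : BStrat, BTierValid k sB → HasUpRun (played sA sB N) m

/-- `B(m,k)`: the least `N` such that player A has a strategy forcing an `m`-up-run
within `N` turns of the tier game `B_{m,k}`. -/
noncomputable def BNum (m k : ℕ) : ℕ := sInf {N | ∃ sA : AStrat, AWinsTierBy m k N sA}

lemma exists_mem_Ioo_notMem (l : List ℝ) : ∃ t ∈ Ioo (0 : ℝ) 1, t ∉ l := by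
  obtain ⟨t, ht, htl⟩ := (Ioo_infinite (zero_lt_one (α := ℝ))).exists_notMem_finset l.toFinset
  exact ⟨t, ht, by simpa using htl⟩

open Classical in
/-- The number `t` if it lies in `(0,1)` and is not in `l`, and otherwise some number in `(0,1)`
that is not in `l`. -/
noncomputable def freshOr (t : ℝ) (l : List ℝ) : ℝ :=
  if t ∈ Ioo (0 : ℝ) 1 ∧ t ∉ l then t else (exists_mem_Ioo_notMem l).choose

lemma freshOr_mem (t : ℝ) (l : List ℝ) : freshOr t l ∈ Ioo (0 : ℝ) 1 := by
  unfold freshOr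
  split_ifs with h
  · exact h.1
  · exact (exists_mem_Ioo_notMem l).choose_spec.1

lemma freshOr_notMem (t : ℝ) (l : List ℝ) : freshOr t l ∉ l := by
  unfold freshOr
  split_ifs with h
  · exact h.2
  · exact (exists_mem_Ioo_notMem l).choose_spec.2

lemma freshOr_eq {t : ℝ} {l : List ℝ} (ht : t ∈ Ioo (0 : ℝ) 1) (hl : t ∉ l) :
    freshOr t l = t := if_pos ⟨ht, hl⟩

/-- The `x`-coordinate player A aims for in `A_{3,3}`: left, right, middle, and then the far end
on the side of whichever of the first two points has the median height. -/
noncomputable def threeTargetA : List Pt → ℝ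
  | [] => 1 / 4
  | [_] => 3 / 4
  | [_, _] => 1 / 2
  | p :: q :: r :: _ => if (p.2 < q.2 ↔ q.2 < r.2) then 7 / 8 else 1 / 8

/-- The winning strategy of player A in `A_{3,3}`. -/
noncomputable def threeStratA : AStrat := fun h => freshOr (threeTargetA h) (h.map Prod.fst)

open Classical in
/-- The `y`-coordinate player B aims for in `A_{3,3}`: the third point is topmost if it lies
between the first two, and otherwise it has the median height. -/
noncomputable def threeTargetB : List Pt → ℝ → ℝ
  | [], _ => 1 / 2
  | [_], _ => 3 / 4
  | p :: q :: _, x => if (p.1 < x ↔ x < q.1) then 7 / 8 else 5 / 8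

/-- A strategy of player B surviving three turns of `A_{3,3}`. -/
noncomputable def threeStratB : BStrat :=
  fun h x => freshOr (threeTargetB h x) (h.map Prod.snd)

lemma aValid_threeStratA : AValid threeStratA := fun h =>
  ⟨freshOr_mem _ _, fun _ hp he => freshOr_notMem (threeTargetA h) (h.map Prod.fst)
    (List.mem_map.2 ⟨_, hp, he.symm⟩)⟩

lemma bValid_threeStratB : BValid threeStratB := fun h x =>
  ⟨freshOr_mem _ _, fun _ hp he => freshOr_notMem (threeTargetB h x) (h.map Prod.snd)
    (List.mem_map.2 ⟨_, hp, he.symm⟩)⟩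

lemma hasUpRun_three {P : Set Pt} {a b c : Pt} (ha : a ∈ P) (hb : b ∈ P) (hc : c ∈ P)
    (hab : a.1 < b.1) (hbc : b.1 < c.1) (hab' : a.2 ≤ b.2) (hbc' : b.2 ≤ c.2) :
    HasUpRun P 3 := by
  refine ⟨![a, b, c], ?_, ?_, ?_⟩
  · simp [Fin.forall_fin_succ, ha, hb, hc]
  · simp [Fin.strictMono_iff_lt_succ, Fin.forall_fin_succ, hab, hbc]
  · simp [Fin.monotone_iff_le_succ, Fin.forall_fin_succ, hab', hbc']

lemma hasDownRun_three {P : Set Pt} {a b c : Pt} (ha : a ∈ P) (hb : b ∈ P) (hc : c ∈ P)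
    (hab : a.1 < b.1) (hbc : b.1 < c.1) (hab' : b.2 < a.2) (hbc' : c.2 < b.2) :
    HasDownRun P 3 := by
  refine ⟨![a, b, c], ?_, ?_, ?_⟩
  · simp [Fin.forall_fin_succ, ha, hb, hc]
  · simp [Fin.strictMono_iff_lt_succ, Fin.forall_fin_succ, hab, hbc]
  · simp [Fin.strictAnti_iff_succ_lt, Fin.forall_fin_succ, hab', hbc']

lemma HasUpRun.mono {P Q : Set Pt} {n : ℕ} (hPQ : P ⊆ Q) : HasUpRun P n → HasUpRun Q n :=
  fun ⟨f, hf, h⟩ => ⟨f, fun i => hPQ (hf i), h⟩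

lemma HasDownRun.mono {P Q : Set Pt} {n : ℕ} (hPQ : P ⊆ Q) : HasDownRun P n → HasDownRun Q n :=
  fun ⟨f, hf, h⟩ => ⟨f, fun i => hPQ (hf i), h⟩

lemma played_mono (sA : AStrat) (sB : BStrat) : Monotone (played sA sB) :=
  monotone_nat_of_le_succ fun _ _ hp => List.mem_append_left _ hp

lemma aWinsBy_threeStratA : AWinsBy 3 3 4 threeStratA := by
  refine ⟨aValid_threeStratA, fun sB hB => ?_⟩
  obtain ⟨y₁, hy₁⟩ : ∃ y, y = sB [] (1 / 4) := ⟨_, rfl⟩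
  obtain ⟨y₂, hy₂⟩ : ∃ y, y = sB [(1 / 4, y₁)] (3 / 4) := ⟨_, rfl⟩
  obtain ⟨y₃, hy₃⟩ : ∃ y, y = sB [(1 / 4, y₁), (3 / 4, y₂)] (1 / 2) := ⟨_, rfl⟩
  have h₁ : hist threeStratA sB 1 = [(1 / 4, y₁)] := by
    have : threeStratA [] = 1 / 4 := freshOr_eq (by norm_num [threeTargetA]) (by simp)
    simp only [hist, List.nil_append, this, hy₁]
  have h₂ : hist threeStratA sB 2 = [(1 / 4, y₁), (3 / 4, y₂)] := by
    have : threeStratA [(1 / 4, y₁)] = 3 / 4 :=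
      freshOr_eq (by norm_num [threeTargetA]) (by norm_num [threeTargetA])
    rw [hist, h₁]
    simp only [this, ← hy₂, List.cons_append, List.nil_append]
  have h₃ : hist threeStratA sB 3 = [(1 / 4, y₁), (3 / 4, y₂), (1 / 2, y₃)] := by
    have : threeStratA [(1 / 4, y₁), (3 / 4, y₂)] = 1 / 2 :=
      freshOr_eq (by norm_num [threeTargetA]) (by norm_num [threeTargetA])
    rw [hist, h₂]
    simp only [this, ← hy₃, List.cons_append, List.nil_append]
  have hx : threeStratA [(1 / 4, y₁), (3 / 4, y₂), (1 / 2, y₃)] =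
      if (y₁ < y₂ ↔ y₂ < y₃) then 7 / 8 else 1 / 8 := by
    refine freshOr_eq ?_ ?_ <;> simp only [threeTargetA] <;> split_ifs <;> norm_num
  obtain ⟨x₄, hx₄⟩ : ∃ x, x = threeStratA [(1 / 4, y₁), (3 / 4, y₂), (1 / 2, y₃)] := ⟨_, rfl⟩
  obtain ⟨y₄, hy₄⟩ : ∃ y, y = sB [(1 / 4, y₁), (3 / 4, y₂), (1 / 2, y₃)] x₄ := ⟨_, rfl⟩
  have h₄ : hist threeStratA sB 4 = [(1 / 4, y₁), (3 / 4, y₂), (1 / 2, y₃), (x₄, y₄)] := by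
    rw [hist, h₃]
    simp only [← hx₄, ← hy₄, List.cons_append, List.nil_append]
  have n₂ : y₂ ≠ y₁ := hy₂ ▸ (hB _ _).2 (1 / 4, y₁) (by simp)
  have n₃ : y₃ ≠ y₁ ∧ y₃ ≠ y₂ :=
    ⟨hy₃ ▸ (hB _ _).2 (1 / 4, y₁) (by simp), hy₃ ▸ (hB _ _).2 (3 / 4, y₂) (by simp)⟩
  have m₁ : ((1 / 4, y₁) : Pt) ∈ played threeStratA sB 4 := by simp [played, h₄]
  have m₂ : ((3 / 4, y₂) : Pt) ∈ played threeStratA sB 4 := by simp [played, h₄]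
  have m₃ : ((1 / 2, y₃) : Pt) ∈ played threeStratA sB 4 := by simp [played, h₄]
  have m₄ : ((x₄, y₄) : Pt) ∈ played threeStratA sB 4 := by simp [played, h₄]
  have n₄ : y₄ ≠ y₁ ∧ y₄ ≠ y₂ :=
    ⟨hy₄ ▸ (hB _ _).2 (1 / 4, y₁) (by simp), hy₄ ▸ (hB _ _).2 (3 / 4, y₂) (by simp)⟩
  have x₁₃ : (1 / 4 : ℝ) < 1 / 2 := by norm_num
  have x₃₂ : (1 / 2 : ℝ) < 3 / 4 := by norm_num
  have x₁₂ : (1 / 4 : ℝ) < 3 / 4 := by norm_num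
  rw [hx] at hx₄
  by_contra! hno
  obtain ⟨hup, hdown⟩ := hno
  have u := fun a b c ha hb hc hab hbc hab' hbc' =>
    hup (hasUpRun_three (a := a) (b := b) (c := c) ha hb hc hab hbc hab' hbc')
  have d := fun a b c ha hb hc hab hbc hab' hbc' =>
    hdown (hasDownRun_three (a := a) (b := b) (c := c) ha hb hc hab hbc hab' hbc')
  have u₁₃₂ := u _ _ _ m₁ m₃ m₂ x₁₃ x₃₂
  have d₁₃₂ := d _ _ _ m₁ m₃ m₂ x₁₃ x₃₂
  dsimp only at u₁₃₂ d₁₃₂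
  split_ifs at hx₄
  · have x₂₄ : (3 / 4 : ℝ) < x₄ := by rw [hx₄]; norm_num
    have u₁ := u _ _ _ m₁ m₂ m₄ x₁₂ x₂₄
    have d₁ := d _ _ _ m₁ m₂ m₄ x₁₂ x₂₄
    have u₃ := u _ _ _ m₃ m₂ m₄ x₃₂ x₂₄
    have d₃ := d _ _ _ m₃ m₂ m₄ x₃₂ x₂₄
    dsimp only at u₁ d₁ u₃ d₃
    grind
  · have x₄₁ : x₄ < (1 / 4 : ℝ) := by rw [hx₄]; norm_num
    have u₂ := u _ _ _ m₄ m₁ m₂ x₄₁ x₁₂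
    have d₂ := d _ _ _ m₄ m₁ m₂ x₄₁ x₁₂
    have u₃ := u _ _ _ m₄ m₁ m₃ x₄₁ x₁₃
    have d₃ := d _ _ _ m₄ m₁ m₃ x₄₁ x₁₃
    dsimp only at u₂ d₂ u₃ d₃
    grind

lemma not_hasRun_threeStratB (sA : AStrat) (hA : AValid sA) :
    ¬ HasUpRun (played sA threeStratB 3) 3 ∧ ¬ HasDownRun (played sA threeStratB 3) 3 := by
  obtain ⟨x₁, hx₁⟩ : ∃ x, x = sA [] := ⟨_, rfl⟩
  obtain ⟨x₂, hx₂⟩ : ∃ x, x = sA [(x₁, 1 / 2)] := ⟨_, rfl⟩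
  obtain ⟨x₃, hx₃⟩ : ∃ x, x = sA [(x₁, 1 / 2), (x₂, 3 / 4)] := ⟨_, rfl⟩
  obtain ⟨y₃, hy₃⟩ : ∃ y : ℝ, y = if (x₁ < x₃ ↔ x₃ < x₂) then 7 / 8 else 5 / 8 := ⟨_, rfl⟩
  have h₁ : hist sA threeStratB 1 = [(x₁, 1 / 2)] := by
    have : threeStratB [] x₁ = 1 / 2 := freshOr_eq (by norm_num [threeTargetB]) (by simp)
    simp only [hist, List.nil_append, ← hx₁, this]
  have h₂ : hist sA threeStratB 2 = [(x₁, 1 / 2), (x₂, 3 / 4)] := by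
    have : threeStratB [(x₁, 1 / 2)] x₂ = 3 / 4 :=
      freshOr_eq (by norm_num [threeTargetB]) (by norm_num [threeTargetB])
    rw [hist, h₁]
    simp only [← hx₂, this, List.cons_append, List.nil_append]
  have h₃ : hist sA threeStratB 3 = [(x₁, 1 / 2), (x₂, 3 / 4), (x₃, y₃)] := by
    have : threeStratB [(x₁, 1 / 2), (x₂, 3 / 4)] x₃ = y₃ := by
      rw [hy₃]
      refine freshOr_eq ?_ ?_ <;> simp only [threeTargetB] <;> split_ifs <;> norm_num
    rw [hist, h₂]
    simp only [← hx₃, this, List.cons_append, List.nil_append]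
  have n₂ : x₂ ≠ x₁ := hx₂ ▸ (hA _).2 (x₁, 1 / 2) (by simp)
  have n₃ : x₃ ≠ x₁ ∧ x₃ ≠ x₂ :=
    ⟨hx₃ ▸ (hA _).2 (x₁, 1 / 2) (by simp), hx₃ ▸ (hA _).2 (x₂, 3 / 4) (by simp)⟩
  have hmem : ∀ p ∈ played sA threeStratB 3,
      p = (x₁, 1 / 2) ∨ p = (x₂, 3 / 4) ∨ p = (x₃, y₃) := by
    simp [played, h₃]
  constructor
  · rintro ⟨f, hf, hx, hy⟩
    have a := hx (show (0 : Fin 3) < 1 by decide)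
    have b := hx (show (1 : Fin 3) < 2 by decide)
    have c := hy (show (0 : Fin 3) ≤ 1 by decide)
    have d := hy (show (1 : Fin 3) ≤ 2 by decide)
    dsimp only at a b c d
    rcases hmem _ (hf 0) with h0 | h0 | h0 <;> rcases hmem _ (hf 1) with h1 | h1 | h1 <;>
      rcases hmem _ (hf 2) with h2 | h2 | h2 <;> rw [h0, h1] at a c <;> rw [h1, h2] at b d <;>
      dsimp only at a b c d <;> split_ifs at hy₃ <;> grind
  · rintro ⟨f, hf, hx, hy⟩
    have a := hx (show (0 : Fin 3) < 1 by decide)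
    have b := hx (show (1 : Fin 3) < 2 by decide)
    have c := hy (show (0 : Fin 3) < 1 by decide)
    have d := hy (show (1 : Fin 3) < 2 by decide)
    dsimp only at a b c d
    rcases hmem _ (hf 0) with h0 | h0 | h0 <;> rcases hmem _ (hf 1) with h1 | h1 | h1 <;>
      rcases hmem _ (hf 2) with h2 | h2 | h2 <;> rw [h0, h1] at a c <;> rw [h1, h2] at b d <;>
      dsimp only at a b c d <;> split_ifs at hy₃ <;> grind

theorem ESO_three_three : ESO 3 3 = 4 ∧
    (∃ sA : AStrat, AWinsBy 3 3 4 sA) ∧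
    ∃ sB : BStrat, BValid sB ∧ ∀ sA : AStrat, AValid sA →
      ¬ HasUpRun (played sA sB 3) 3 ∧ ¬ HasDownRun (played sA sB 3) 3 := by
  refine ⟨le_antisymm (Nat.sInf_le ⟨_, aWinsBy_threeStratA⟩) ?_, ⟨_, aWinsBy_threeStratA⟩,
    threeStratB, bValid_threeStratB, not_hasRun_threeStratB⟩
  refine le_csInf ⟨4, _, aWinsBy_threeStratA⟩ ?_
  rintro N ⟨sA, hA, hwin⟩
  by_contra! hN
  have hsub := played_mono sA threeStratB (Nat.le_of_lt_succ hN)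
  obtain ⟨hup, hdown⟩ := not_hasRun_threeStratB sA hA
  exact (hwin _ bValid_threeStratB).elim (fun h => hup (h.mono hsub)) fun h => hdown (h.mono hsub)
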